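/- Uniformly homotopic maps are uniformly Vietoris homotopic: Let (X, A) and (Y, B) be uniform pairs and let f, g : (X, A) → (Y, B) be uniformly continuous maps of pairs. If f and g are uniformly homotopic, then f and g are uniformly Vietoris homotopic. -/

import Mathlib

/-- A map `f : X → Y` is uniformly `V`-continuous (`V` an entourage of `Y`) if there is
an entourage `U` of `X` with `f(U[x]) ⊆ V[f(x)]` for all `x`. -/
def UniformlyVContinuous {X Y : Type*} [UniformSpace X] (V : Set (Y × Y)) (f : X → Y) :
    Prop :=
  ∃ U ∈ uniformity X, ∀ x y : X, (x, y) ∈ U → (f x, f y) ∈ V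

/-- Maps of pairs `f, g : (X, A) → (Y, B)` are uniformly `V`-homotopic if there is a
finite chain of uniformly `V`-continuous maps of pairs from `f` to `g` whose adjacent
members are pointwise `V`-close. -/
def UniformlyVHomotopic {X Y : Type*} [UniformSpace X] (A : Set X) (B : Set Y)
    (V : Set (Y × Y)) (f g : X → Y) : Prop :=
  ∃ (n : ℕ) (h : ℕ → X → Y), h 0 = f ∧ h n = g ∧
    (∀ i ≤ n, Set.MapsTo (h i) A B ∧ UniformlyVContinuous V (h i)) ∧
    (∀ i < n, ∀ x : X, (h i x, h (i + 1) x) ∈ V)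

/-- Maps of pairs are uniformly Vietoris homotopic if they are uniformly `V`-homotopic
for every entourage `V` of `Y`. -/
def UniformlyVietorisHomotopic {X Y : Type*} [UniformSpace X] [UniformSpace Y]
    (A : Set X) (B : Set Y) (f g : X → Y) : Prop :=
  ∀ V ∈ uniformity Y, UniformlyVHomotopic A B V f g

/-- **Uniformly homotopic maps are uniformly Vietoris homotopic.** If uniformly
continuous maps of pairs `f, g : (X, A) → (Y, B)` are uniformly homotopic (via a
uniformly continuous homotopy of pairs `H : X × [0,1] → Y`), then they are uniformly
Vietoris homotopic. -/
theorem uniformlyVietorisHomotopic_of_uniformly_homotopic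
    {X Y : Type*} [UniformSpace X] [UniformSpace Y] (A : Set X) (B : Set Y)
    (f g : X → Y) (hf : UniformContinuous f) (hg : UniformContinuous g)
    (hfA : Set.MapsTo f A B) (hgA : Set.MapsTo g A B)
    (H : X × unitInterval → Y) (hH : UniformContinuous H)
    (hH0 : ∀ x : X, H (x, 0) = f x) (hH1 : ∀ x : X, H (x, 1) = g x)
    (hHB : ∀ a ∈ A, ∀ t : unitInterval, H (a, t) ∈ B) :
    UniformlyVietorisHomotopic A B f g := by
  intro V hV
  have hV' := hH hV
  rw [Filter.mem_map, uniformity_prod_eq_comap_prod, Filter.mem_comap] at hV'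
  obtain ⟨W, hW, hWV⟩ := hV'
  obtain ⟨P, hP, Q, hQ, hPQ⟩ := Filter.mem_prod_iff.1 hW
  have hclose : ∀ x y : X, (x, y) ∈ P → ∀ s t : unitInterval, (s, t) ∈ Q →
      (H (x, s), H (y, t)) ∈ V := fun x y hxy s t hst =>
    hWV (a := ((x, s), (y, t))) (hPQ (Set.mk_mem_prod hxy hst))
  obtain ⟨ε, hε, hεQ⟩ := Metric.mem_uniformity_dist.1 hQ
  obtain ⟨n, hn⟩ := exists_nat_one_div_lt hε
  have hn0 : (0 : ℝ) < n + 1 := by positivity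
  let p : ℕ → unitInterval := fun i => Set.projIcc 0 1 zero_le_one ((i : ℝ) / (n + 1))
  have hp0 : p 0 = 0 := by simp [p]
  have hp1 : p (n + 1) = 1 := by simp [p, div_self hn0.ne']
  have hp : ∀ i, dist (p i) (p (i + 1)) < ε := fun i => by
    refine lt_of_le_of_lt ((LipschitzWith.projIcc zero_le_one).dist_le_mul _ _) ?_
    have hstep : (i : ℝ) / (n + 1) - ((i + 1 : ℕ) : ℝ) / (n + 1) = -(1 / (n + 1)) := by
      push_cast
      ring
    rw [Real.dist_eq, hstep, abs_neg, abs_of_pos (by positivity)]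
    simpa using hn
  refine ⟨n + 1, fun i x => H (x, p i), ?_, ?_, fun i _ => ⟨fun a ha => hHB a ha _, P, hP, ?_⟩, ?_⟩
  · funext x
    simp only [hp0, hH0]
  · funext x
    simp only [hp1, hH1]
  · exact fun x y hxy => hclose x y hxy _ _ (refl_mem_uniformity hQ)
  · exact fun i _ x => hclose x x (refl_mem_uniformity hP) _ _ (hεQ (hp i))
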